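/- arXiv:gr-qc/9903034 — 2 statements merged into one kernel-verified Lean document; each statement's English description precedes it below -/
import Mathlib

section
/- For parameters $m > 0$, $\alpha > 0$, $g > 0$, the equation of state becomes ultrarelativistic at high density: $\lim_{\psi \to 0^+} \dfrac{p_F(\psi)}{\rho_F(\psi)} = \dfrac{1}{3}$. -/
open Set Real MeasureTheory

/-- The relativistic single-particle energy `E(q) = √(m² + q²)`. -/
noncomputable def fermiE (m q : ℝ) : ℝ := Real.sqrt (m ^ 2 + q ^ 2)

/-- The Fermi distribution factor `f(q,ψ) = (1 + exp(α(ψE(q) - m)/m))⁻¹`,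
where `ψ` parametrizes the local temperature `T = m/(αψ)` and chemical
potential `μ = m/ψ`. -/
noncomputable def fermiF (m α ψ q : ℝ) : ℝ :=
  (1 + Real.exp (α * (ψ * fermiE m q - m) / m))⁻¹

/-- Thomas–Fermi number density `n_F(ψ) = (g/2π²) ∫₀^∞ q² f(q,ψ) dq`. -/
noncomputable def nF (m α g ψ : ℝ) : ℝ :=
  g / (2 * π ^ 2) * ∫ q in Ioi (0:ℝ), q ^ 2 * fermiF m α ψ q

/-- Thomas–Fermi energy density `ρ_F(ψ) = (g/2π²) ∫₀^∞ q² E(q) f(q,ψ) dq`. -/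
noncomputable def rhoF (m α g ψ : ℝ) : ℝ :=
  g / (2 * π ^ 2) * ∫ q in Ioi (0:ℝ), q ^ 2 * fermiE m q * fermiF m α ψ q

/-- Thomas–Fermi pressure `p_F(ψ) = (g/6π²) ∫₀^∞ (q⁴/E(q)) f(q,ψ) dq`. -/
noncomputable def pF (m α g ψ : ℝ) : ℝ :=
  g / (6 * π ^ 2) * ∫ q in Ioi (0:ℝ), q ^ 4 / fermiE m q * fermiF m α ψ q

/-- The Fermi factor as a function of the rescaled energy `e = ψE`. -/
noncomputable def fermiWeight (m α e : ℝ) : ℝ := (1 + Real.exp (α * (e - m) / m))⁻¹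

lemma fermiWeight_pos (m α e : ℝ) : 0 < fermiWeight m α e := by
  unfold fermiWeight; positivity

lemma continuous_fermiWeight (m α : ℝ) : Continuous (fermiWeight m α) := by
  unfold fermiWeight
  exact Continuous.inv₀ (by fun_prop) fun e => by positivity

lemma fermiWeight_le {m α x e : ℝ} (hm : 0 < m) (hα : 0 < α) (hxe : x ≤ e) :
    fermiWeight m α e ≤ Real.exp α * Real.exp (-(α / m) * x) := by
  rw [← Real.exp_add]
  unfold fermiWeight
  calc (1 + Real.exp (α * (e - m) / m))⁻¹ ≤ (Real.exp (α * (e - m) / m))⁻¹ := by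
        gcongr; linarith
    _ = Real.exp (-(α * (e - m) / m)) := (Real.exp_neg _).symm
    _ ≤ Real.exp (α + -(α / m) * x) := by
        gcongr
        have h : α + -(α / m) * x - -(α * (e - m) / m) = α / m * (e - x) := by
          field_simp; ring
        have : 0 ≤ α / m * (e - x) := mul_nonneg (by positivity) (by linarith)
        linarith

lemma continuous_fermiE : Continuous fun p : ℝ × ℝ => fermiE p.1 p.2 := by
  unfold fermiE; fun_prop

lemma fermiE_zero {q : ℝ} (hq : 0 ≤ q) : fermiE 0 q = q := by
  simp [fermiE, Real.sqrt_sq hq]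

lemma le_fermiE (m q : ℝ) : q ≤ fermiE m q :=
  Real.le_sqrt_of_sq_le (by nlinarith [sq_nonneg m])

lemma fermiE_le_add {m q : ℝ} (hm : 0 ≤ m) (hq : 0 ≤ q) : fermiE m q ≤ m + q :=
  (Real.sqrt_le_left (by positivity)).2 (by nlinarith [mul_nonneg hm hq])

lemma mul_fermiE {m ψ q : ℝ} (hψ : 0 ≤ ψ) : ψ * fermiE m q = fermiE (m * ψ) (ψ * q) := by
  unfold fermiE
  rw [show (m * ψ) ^ 2 + (ψ * q) ^ 2 = ψ ^ 2 * (m ^ 2 + q ^ 2) by ring,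
    Real.sqrt_mul (sq_nonneg ψ), Real.sqrt_sq hψ]

lemma fermiF_eq_fermiWeight {m α ψ q : ℝ} (hψ : 0 ≤ ψ) :
    fermiF m α ψ q = fermiWeight m α (fermiE (m * ψ) (ψ * q)) := by
  rw [← mul_fermiE hψ]; rfl

/-- The energy-density integrand in the rescaled momentum `x = ψq`. -/
noncomputable def scaledEnergyIntegrand (m α ψ x : ℝ) : ℝ :=
  x ^ 2 * fermiE (m * ψ) x * fermiWeight m α (fermiE (m * ψ) x)

/-- The pressure integrand in the rescaled momentum `x = ψq`. -/
noncomputable def scaledPressureIntegrand (m α ψ x : ℝ) : ℝ :=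
  x ^ 4 / fermiE (m * ψ) x * fermiWeight m α (fermiE (m * ψ) x)

lemma setIntegral_energy_eq {m α ψ : ℝ} (hψ : 0 < ψ) :
    ∫ q in Ioi (0 : ℝ), q ^ 2 * fermiE m q * fermiF m α ψ q
      = (ψ ^ 4)⁻¹ * ∫ x in Ioi (0 : ℝ), scaledEnergyIntegrand m α ψ x := by
  have h := integral_comp_mul_left_Ioi (scaledEnergyIntegrand m α ψ) 0 hψ
  rw [mul_zero, smul_eq_mul] at h
  have h' : ∀ q, q ^ 2 * fermiE m q * fermiF m α ψ q
      = (ψ ^ 3)⁻¹ * scaledEnergyIntegrand m α ψ (ψ * q) := fun q => by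
    rw [scaledEnergyIntegrand, fermiF_eq_fermiWeight hψ.le, ← mul_fermiE hψ.le]
    field_simp
  simp_rw [h']
  rw [integral_const_mul, h]
  field_simp

lemma setIntegral_pressure_eq {m α ψ : ℝ} (hψ : 0 < ψ) :
    ∫ q in Ioi (0 : ℝ), q ^ 4 / fermiE m q * fermiF m α ψ q
      = (ψ ^ 4)⁻¹ * ∫ x in Ioi (0 : ℝ), scaledPressureIntegrand m α ψ x := by
  have h := integral_comp_mul_left_Ioi (scaledPressureIntegrand m α ψ) 0 hψ
  rw [mul_zero, smul_eq_mul] at h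
  have h' : ∀ q, q ^ 4 / fermiE m q * fermiF m α ψ q
      = (ψ ^ 3)⁻¹ * scaledPressureIntegrand m α ψ (ψ * q) := fun q => by
    rw [scaledPressureIntegrand, fermiF_eq_fermiWeight hψ.le, ← mul_fermiE hψ.le]
    field_simp
  simp_rw [h']
  rw [integral_const_mul, h]
  field_simp

/-- An integrable majorant of the rescaled integrands, uniform in `ψ ∈ (0, 1]`. -/
noncomputable def scaledBound (m α x : ℝ) : ℝ :=
  x ^ 2 * (m + x) * (Real.exp α * Real.exp (-(α / m) * x))

lemma integrableOn_scaledBound {m α : ℝ} (hm : 0 < m) (hα : 0 < α) :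
    IntegrableOn (scaledBound m α) (Ioi 0) := by
  have h (n : ℕ) : IntegrableOn (fun x : ℝ => x ^ n * Real.exp (-(α / m) * x)) (Ioi 0) := by
    have := integrableOn_rpow_mul_exp_neg_mul_rpow (p := 1) (s := n) (b := α / m)
      (by have : (0 : ℝ) ≤ n := n.cast_nonneg
          linarith) one_pos (by positivity)
    simpa using this
  refine IntegrableOn.congr_fun
    (((h 2).const_mul (m * Real.exp α)).add ((h 3).const_mul (Real.exp α)))
    (fun x _ => ?_) measurableSet_Ioi
  simp only [scaledBound, Pi.add_apply]
  ring

lemma scaledEnergyIntegrand_le {m α ψ x : ℝ} (hm : 0 < m) (hα : 0 < α) (hψ : 0 < ψ)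
    (hψ1 : ψ ≤ 1) (hx : 0 < x) : scaledEnergyIntegrand m α ψ x ≤ scaledBound m α x := by
  have h1 : fermiE (m * ψ) x ≤ m + x :=
    (fermiE_le_add (by positivity) hx.le).trans (by nlinarith)
  have h2 := fermiWeight_le hm hα (le_fermiE (m * ψ) x)
  have h3 := fermiWeight_pos m α (fermiE (m * ψ) x)
  unfold scaledEnergyIntegrand scaledBound
  gcongr

lemma scaledPressureIntegrand_le_scaledEnergyIntegrand {m α ψ x : ℝ} (hx : 0 < x) :
    scaledPressureIntegrand m α ψ x ≤ scaledEnergyIntegrand m α ψ x := by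
  have h1 := le_fermiE (m * ψ) x
  have h2 : 0 < fermiE (m * ψ) x := hx.trans_le h1
  refine mul_le_mul_of_nonneg_right ?_ (fermiWeight_pos _ _ _).le
  rw [div_le_iff₀ h2]
  calc x ^ 4 = x ^ 2 * x * x := by ring
    _ ≤ x ^ 2 * fermiE (m * ψ) x * fermiE (m * ψ) x := by gcongr

lemma scaledEnergyIntegrand_nonneg (m α ψ x : ℝ) : 0 ≤ scaledEnergyIntegrand m α ψ x := by
  have := fermiWeight_pos m α (fermiE (m * ψ) x)
  have : 0 ≤ fermiE (m * ψ) x := Real.sqrt_nonneg _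
  unfold scaledEnergyIntegrand; positivity

lemma scaledPressureIntegrand_nonneg (m α ψ x : ℝ) : 0 ≤ scaledPressureIntegrand m α ψ x := by
  have := fermiWeight_pos m α (fermiE (m * ψ) x)
  have : 0 ≤ fermiE (m * ψ) x := Real.sqrt_nonneg _
  unfold scaledPressureIntegrand; positivity

/-- The common massless limit of the rescaled integrands. -/
noncomputable def masslessIntegrand (m α x : ℝ) : ℝ := x ^ 3 * fermiWeight m α x

lemma continuous_masslessIntegrand (m α : ℝ) : Continuous (masslessIntegrand m α) := by
  have := continuous_fermiWeight m α
  unfold masslessIntegrand; fun_prop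

lemma integral_masslessIntegrand_pos {m α : ℝ} (hm : 0 < m) (hα : 0 < α) :
    0 < ∫ x in Ioi (0 : ℝ), masslessIntegrand m α x := by
  have hpos : ∀ x ∈ Ioi (0 : ℝ), 0 < masslessIntegrand m α x := fun x hx =>
    mul_pos (pow_pos hx 3) (fermiWeight_pos m α x)
  have hint : IntegrableOn (masslessIntegrand m α) (Ioi 0) := by
    refine (integrableOn_scaledBound hm hα).mono'
      (continuous_masslessIntegrand m α).aestronglyMeasurable
      ((ae_restrict_iff' measurableSet_Ioi).2 (.of_forall fun x hx => ?_))
    rw [Real.norm_of_nonneg (hpos x hx).le]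
    have hx' : 0 < x := hx
    have h2 := fermiWeight_le hm hα (le_refl x)
    have h3 := fermiWeight_pos m α x
    unfold masslessIntegrand scaledBound
    have : x ^ 3 ≤ x ^ 2 * (m + x) := by nlinarith [mul_pos hm (pow_pos hx' 2)]
    gcongr
  rw [setIntegral_pos_iff_support_of_nonneg_ae
    ((ae_restrict_iff' measurableSet_Ioi).2 (.of_forall fun x hx => (hpos x hx).le)) hint]
  have hsupp : Ioi (0 : ℝ) ⊆ Function.support (masslessIntegrand m α) := fun x hx =>
    (hpos x hx).ne'
  rw [inter_eq_right.2 hsupp]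
  simp

lemma tendsto_fermiE_mul (m x : ℝ) (hx : 0 < x) :
    Filter.Tendsto (fun ψ => fermiE (m * ψ) x) (nhdsWithin 0 (Ioi 0)) (nhds x) := by
  have h : Continuous fun ψ : ℝ => fermiE (m * ψ) x :=
    continuous_fermiE.comp (by fun_prop : Continuous fun ψ : ℝ => (m * ψ, x))
  simpa [fermiE_zero hx.le] using (h.tendsto 0).mono_left nhdsWithin_le_nhds

lemma eventually_pos_le_one : ∀ᶠ ψ : ℝ in nhdsWithin 0 (Ioi 0), 0 < ψ ∧ ψ ≤ 1 := by
  filter_upwards [Ioc_mem_nhdsGT (zero_lt_one' ℝ)] with ψ hψ using hψ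

lemma tendsto_integral_scaledEnergyIntegrand {m α : ℝ} (hm : 0 < m) (hα : 0 < α) :
    Filter.Tendsto (fun ψ => ∫ x in Ioi (0 : ℝ), scaledEnergyIntegrand m α ψ x)
      (nhdsWithin 0 (Ioi 0)) (nhds (∫ x in Ioi (0 : ℝ), masslessIntegrand m α x)) := by
  have hw := continuous_fermiWeight m α
  refine tendsto_integral_filter_of_dominated_convergence (scaledBound m α)
    (.of_forall fun ψ => ?_) ?_ (integrableOn_scaledBound hm hα) ?_
  · have hE : Continuous fun x : ℝ => fermiE (m * ψ) x :=
      continuous_fermiE.comp (by fun_prop : Continuous fun x : ℝ => (m * ψ, x))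
    refine Continuous.aestronglyMeasurable ?_
    unfold scaledEnergyIntegrand
    fun_prop
  · filter_upwards [eventually_pos_le_one] with ψ hψ
    refine (ae_restrict_iff' measurableSet_Ioi).2 (.of_forall fun x hx => ?_)
    rw [Real.norm_of_nonneg (scaledEnergyIntegrand_nonneg m α ψ x)]
    exact scaledEnergyIntegrand_le hm hα hψ.1 hψ.2 hx
  · refine (ae_restrict_iff' measurableSet_Ioi).2 (.of_forall fun x hx => ?_)
    have hE := tendsto_fermiE_mul m x hx
    rw [show masslessIntegrand m α x = x ^ 2 * x * fermiWeight m α x by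
      unfold masslessIntegrand; ring]
    exact (hE.const_mul _).mul ((hw.tendsto x).comp hE)

lemma tendsto_integral_scaledPressureIntegrand {m α : ℝ} (hm : 0 < m) (hα : 0 < α) :
    Filter.Tendsto (fun ψ => ∫ x in Ioi (0 : ℝ), scaledPressureIntegrand m α ψ x)
      (nhdsWithin 0 (Ioi 0)) (nhds (∫ x in Ioi (0 : ℝ), masslessIntegrand m α x)) := by
  have hw := continuous_fermiWeight m α
  refine tendsto_integral_filter_of_dominated_convergence (scaledBound m α)
    (.of_forall fun ψ => ?_) ?_ (integrableOn_scaledBound hm hα) ?_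
  · have hE : Continuous fun x : ℝ => fermiE (m * ψ) x :=
      continuous_fermiE.comp (by fun_prop : Continuous fun x : ℝ => (m * ψ, x))
    refine Measurable.aestronglyMeasurable ?_
    exact ((measurable_id.pow_const 4).div hE.measurable).mul (hw.comp hE).measurable
  · filter_upwards [eventually_pos_le_one] with ψ hψ
    refine (ae_restrict_iff' measurableSet_Ioi).2 (.of_forall fun x hx => ?_)
    rw [Real.norm_of_nonneg (scaledPressureIntegrand_nonneg m α ψ x)]
    exact (scaledPressureIntegrand_le_scaledEnergyIntegrand hx).trans
      (scaledEnergyIntegrand_le hm hα hψ.1 hψ.2 hx)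
  · refine (ae_restrict_iff' measurableSet_Ioi).2 (.of_forall fun x hx => ?_)
    have hx' : x ≠ 0 := ne_of_gt hx
    have hE := tendsto_fermiE_mul m x hx
    rw [show masslessIntegrand m α x = x ^ 4 / x * fermiWeight m α x by
      unfold masslessIntegrand; field_simp]
    exact (tendsto_const_nhds.div hE hx').mul ((hw.tendsto x).comp hE)

/-- The equation of state becomes ultrarelativistic at high density:
`p_F(ψ)/ρ_F(ψ) → 1/3` as `ψ → 0⁺`. -/
theorem thomas_fermi_ultrarelativistic_limit
    (m α g : ℝ) (hm : 0 < m) (hα : 0 < α) (hg : 0 < g) :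
    Filter.Tendsto (fun ψ => pF m α g ψ / rhoF m α g ψ) (nhdsWithin 0 (Ioi 0))
      (nhds (1 / 3)) := by
  have h := ((tendsto_integral_scaledPressureIntegrand hm hα).div
    (tendsto_integral_scaledEnergyIntegrand hm hα)
    (integral_masslessIntegrand_pos hm hα).ne').const_mul (1 / 3)
  rw [div_self (integral_masslessIntegrand_pos hm hα).ne', mul_one] at h
  refine h.congr' ?_
  filter_upwards [self_mem_nhdsWithin] with ψ hψ
  have hψ' : 0 < ψ := hψ
  have hπ := Real.pi_pos
  rw [pF, rhoF, setIntegral_pressure_eq hψ', setIntegral_energy_eq hψ',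
    Pi.div_apply, ← mul_assoc, ← mul_assoc, mul_div_mul_comm]
  congr 1
  field_simp
  norm_num
end

section
/- For parameters $m > 0$, $\alpha > 0$, $g > 0$: the function $p_F : (0,\infty) \to (0,\infty)$ is a strictly decreasing $C^\infty$ bijection of $(0,\infty)$ onto $(0,\infty)$ (with $p_F(\psi) \to \infty$ as $\psi \to 0^+$ and $p_F(\psi) \to 0$ as $\psi \to \infty$), and the energy density expressed as a function of the pressure, $\rho := \rho_F \circ p_F^{-1} : (0,\infty) \to (0,\infty)$, is infinitely differentiable with strictly positive derivative: $d\rho/dp > 0$ for all $p > 0$. -/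
open Set Real MeasureTheory

open Filter Topology Polynomial

/-- The moment `∫ w s Q(s) dμ`, where `s` is the logistic function of `a - ψ e`. -/
noncomputable def logisticMoment {Ω : Type*} [MeasurableSpace Ω] (μ : Measure Ω) (e : Ω → ℝ)
    (a : ℝ) (w : Ω → ℝ) (Q : ℝ[X]) (ψ : ℝ) : ℝ :=
  ∫ x, w x * (sigmoid (a - ψ * e x) * Q.eval (sigmoid (a - ψ * e x))) ∂μ

/-- The weight `w` stays integrable after damping by `exp (-ε e)`, for every `ε > 0`. -/
def DampedIntegrable {Ω : Type*} [MeasurableSpace Ω] (μ : Measure Ω) (e w : Ω → ℝ) : Prop :=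
  AEStronglyMeasurable w μ ∧ ∀ ε > 0, Integrable (fun x => w x * exp (-(ε * e x))) μ

theorem sigmoid_le_exp (x : ℝ) : sigmoid x ≤ exp x := by
  have h := sigmoid_mul_rexp_neg x
  have h1 := sigmoid_le_one (-x)
  calc sigmoid x = sigmoid x * exp (-x) * exp x := by rw [mul_assoc, ← exp_add]; simp
    _ ≤ 1 * exp x := by gcongr; rw [h]; exact h1
    _ = exp x := one_mul _

theorem exists_abs_eval_sigmoid_le (Q : ℝ[X]) : ∃ C, ∀ x, |Q.eval (sigmoid x)| ≤ C := by
  obtain ⟨C, hC⟩ := isCompact_Icc.exists_bound_of_continuousOn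
    (s := Icc (0 : ℝ) 1) (f := fun x => Q.eval x) Q.continuous.continuousOn
  exact ⟨C, fun x => hC _ ⟨sigmoid_nonneg x, sigmoid_le_one x⟩⟩

theorem integral_pos_of_ae_pos {Ω : Type*} [MeasurableSpace Ω] {μ : Measure Ω} [NeZero μ]
    {f : Ω → ℝ} (hf : Integrable f μ) (hpos : ∀ᵐ x ∂μ, 0 < f x) : 0 < ∫ x, f x ∂μ := by
  have hnn : 0 ≤ᵐ[μ] f := hpos.mono fun _ h => h.le
  refine (integral_nonneg_of_ae hnn).lt_of_ne' fun h0 => ?_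
  rw [integral_eq_zero_iff_of_nonneg_ae hnn hf] at h0
  obtain ⟨x, hx, hx0⟩ := (hpos.and h0).exists
  exact hx.ne' hx0

theorem norm_integrand_le {Ω : Type*} {e w : Ω → ℝ} {a C δ ψ : ℝ} {Q : ℝ[X]}
    (he0 : ∀ x, 0 ≤ e x) (hC : ∀ x, |Q.eval (sigmoid x)| ≤ C) (hδ : δ ≤ ψ) (x : Ω) :
    ‖w x * (sigmoid (a - ψ * e x) * Q.eval (sigmoid (a - ψ * e x)))‖ ≤
      C * exp a * ‖w x * exp (-(δ * e x))‖ := by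
  have h1 : sigmoid (a - ψ * e x) ≤ exp a * exp (-(δ * e x)) := by
    rw [← exp_add]
    refine (sigmoid_le_exp _).trans (exp_le_exp.2 ?_)
    have := mul_le_mul_of_nonneg_right hδ (he0 x)
    linarith
  simp only [norm_mul, norm_eq_abs, abs_exp, abs_of_nonneg (sigmoid_nonneg _)]
  calc |w x| * (sigmoid (a - ψ * e x) * |Q.eval (sigmoid (a - ψ * e x))|)
      ≤ |w x| * (exp a * exp (-(δ * e x)) * C) := by
        have := hC (a - ψ * e x)
        gcongr
    _ = _ := by ring

section LogisticMoment

variable {Ω : Type*} [MeasurableSpace Ω] {μ : Measure Ω} {e w : Ω → ℝ} {a : ℝ} {Q : ℝ[X]}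

theorem DampedIntegrable.mul_exponent (he : Measurable e) (he0 : ∀ x, 0 ≤ e x)
    (hw : DampedIntegrable μ e w) : DampedIntegrable μ e (fun x => w x * e x) := by
  refine ⟨hw.1.mul he.aestronglyMeasurable, fun ε hε => ?_⟩
  refine ((hw.2 (ε / 2) (by positivity)).norm.const_mul (2 / ε)).mono'
    ((hw.1.mul he.aestronglyMeasurable).mul
      (by fun_prop : Measurable fun x => exp (-(ε * e x))).aestronglyMeasurable)
    (ae_of_all _ fun x => ?_)
  have h1 : e x ≤ 2 / ε * exp (ε / 2 * e x) := by
    have := add_one_le_exp (ε / 2 * e x)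
    calc e x = 2 / ε * (ε / 2 * e x) := by field_simp
      _ ≤ _ := by gcongr; linarith
  have h2 : exp (ε / 2 * e x) * exp (-(ε * e x)) = exp (-(ε / 2 * e x)) := by
    rw [← exp_add]; ring_nf
  simp only [norm_mul, norm_eq_abs, abs_exp, abs_of_nonneg (he0 x)]
  calc |w x| * e x * exp (-(ε * e x))
      ≤ |w x| * (2 / ε * exp (ε / 2 * e x)) * exp (-(ε * e x)) := by gcongr
    _ = 2 / ε * (|w x| * (exp (ε / 2 * e x) * exp (-(ε * e x)))) := by ring
    _ = _ := by rw [h2]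

theorem DampedIntegrable.mono {v : Ω → ℝ} (he : Measurable e) (hw : DampedIntegrable μ e w)
    (hv : AEStronglyMeasurable v μ) (h : ∀ᵐ x ∂μ, |v x| ≤ |w x|) : DampedIntegrable μ e v := by
  refine ⟨hv, fun ε hε => (hw.2 ε hε).mono (hv.mul
    (by fun_prop : Measurable fun x => exp (-(ε * e x))).aestronglyMeasurable) ?_⟩
  filter_upwards [h] with x hx
  simp only [norm_mul, norm_eq_abs]
  gcongr

theorem DampedIntegrable.aestronglyMeasurable_integrand (he : Measurable e)
    (hw : DampedIntegrable μ e w) (a : ℝ) (Q : ℝ[X]) (ψ : ℝ) :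
    AEStronglyMeasurable
      (fun x => w x * (sigmoid (a - ψ * e x) * Q.eval (sigmoid (a - ψ * e x)))) μ := by
  have hc : Continuous fun y : ℝ => sigmoid (a - y) * Q.eval (sigmoid (a - y)) := by
    have := continuous_sigmoid.comp (continuous_const.sub continuous_id : Continuous fun y => a - y)
    exact this.mul (Q.continuous.comp this)
  exact hw.1.mul (hc.measurable.comp (he.const_mul ψ)).aestronglyMeasurable

theorem DampedIntegrable.integrable_integrand (he : Measurable e) (he0 : ∀ x, 0 ≤ e x)
    (hw : DampedIntegrable μ e w) {ψ : ℝ} (hψ : 0 < ψ) :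
    Integrable (fun x => w x * (sigmoid (a - ψ * e x) * Q.eval (sigmoid (a - ψ * e x)))) μ := by
  obtain ⟨C, hC⟩ := exists_abs_eval_sigmoid_le Q
  exact ((hw.2 ψ hψ).norm.const_mul (C * exp a)).mono'
    (hw.aestronglyMeasurable_integrand he a Q ψ)
    (ae_of_all _ (norm_integrand_le he0 hC le_rfl))

theorem hasDerivAt_integrand (a v y : ℝ) (Q : ℝ[X]) (ψ : ℝ) :
    HasDerivAt (fun ψ => v * (sigmoid (a - ψ * y) * Q.eval (sigmoid (a - ψ * y))))
      (v * y * (sigmoid (a - ψ * y) *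
        ((Q + X * derivative Q) * (X - 1)).eval (sigmoid (a - ψ * y)))) ψ := by
  have h1 : HasDerivAt (fun ψ : ℝ => a - ψ * y) (-y) ψ := by
    simpa using ((hasDerivAt_id ψ).mul_const y).const_sub a
  have h2 := (hasDerivAt_sigmoid (a - ψ * y)).comp ψ h1
  have h3 := (Q.hasDerivAt (sigmoid (a - ψ * y))).comp ψ h2
  refine ((h2.mul h3).const_mul v).congr_deriv ?_
  simp
  ring

theorem DampedIntegrable.hasDerivAt_logisticMoment (he : Measurable e) (he0 : ∀ x, 0 ≤ e x)
    (hw : DampedIntegrable μ e w) {ψ : ℝ} (hψ : 0 < ψ) :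
    HasDerivAt (logisticMoment μ e a w Q)
      (logisticMoment μ e a (fun x => w x * e x) ((Q + X * derivative Q) * (X - 1)) ψ) ψ := by
  have hwe := hw.mul_exponent he he0
  obtain ⟨C, hC⟩ := exists_abs_eval_sigmoid_le ((Q + X * derivative Q) * (X - 1))
  exact (hasDerivAt_integral_of_dominated_loc_of_deriv_le
    (bound := fun x => C * exp a * ‖w x * e x * exp (-(ψ / 2 * e x))‖)
    (Ioi_mem_nhds (half_lt_self hψ))
    (Eventually.of_forall (hw.aestronglyMeasurable_integrand he a Q))
    (hw.integrable_integrand he he0 hψ)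
    (hwe.aestronglyMeasurable_integrand he a _ ψ)
    (ae_of_all _ fun x y hy =>
      norm_integrand_le (w := fun x => w x * e x) he0 hC (le_of_lt hy) x)
    ((hwe.2 (ψ / 2) (half_pos hψ)).norm.const_mul _)
    (ae_of_all _ fun x y _ => hasDerivAt_integrand a (w x) (e x) Q y)).2

theorem DampedIntegrable.contDiffOn_logisticMoment (he : Measurable e) (he0 : ∀ x, 0 ≤ e x)
    (hw : DampedIntegrable μ e w) :
    ContDiffOn ℝ (⊤ : ℕ∞) (logisticMoment μ e a w Q) (Ioi 0) := by
  refine contDiffOn_infty.2 fun n => ?_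
  induction n generalizing w Q with
  | zero =>
    exact contDiffOn_zero.2 fun ψ hψ =>
      (hw.hasDerivAt_logisticMoment he he0 hψ).continuousAt.continuousWithinAt
  | succ n ih =>
    push_cast
    refine (contDiffOn_succ_iff_deriv_of_isOpen isOpen_Ioi).2 ⟨fun ψ hψ =>
      (hw.hasDerivAt_logisticMoment he he0 hψ).differentiableAt.differentiableWithinAt,
      by simp, ?_⟩
    exact (ih (hw.mul_exponent he he0)).congr fun ψ hψ =>
      (hw.hasDerivAt_logisticMoment he he0 hψ).deriv

theorem DampedIntegrable.deriv_logisticMoment_one_neg [NeZero μ] (he : Measurable e)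
    (he0 : ∀ x, 0 < e x) (hw : DampedIntegrable μ e w) (hpos : ∀ᵐ x ∂μ, 0 < w x) {ψ : ℝ}
    (hψ : 0 < ψ) : deriv (logisticMoment μ e a w 1) ψ < 0 := by
  have he0' : ∀ x, 0 ≤ e x := fun x => (he0 x).le
  rw [(hw.hasDerivAt_logisticMoment he he0' hψ).deriv, logisticMoment, ← neg_pos, ← integral_neg]
  refine integral_pos_of_ae_pos ((hw.mul_exponent he he0').integrable_integrand he he0' hψ).neg ?_
  filter_upwards [hpos] with x hx
  have h0 := sigmoid_pos (a - ψ * e x)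
  have h1 := sub_pos.2 (sigmoid_lt_one (a - ψ * e x))
  have := mul_pos (mul_pos hx (he0 x)) (mul_pos h0 h1)
  simp
  linarith

theorem DampedIntegrable.logisticMoment_one_pos [NeZero μ] (he : Measurable e)
    (he0 : ∀ x, 0 ≤ e x) (hw : DampedIntegrable μ e w) (hpos : ∀ᵐ x ∂μ, 0 < w x) {ψ : ℝ}
    (hψ : 0 < ψ) : 0 < logisticMoment μ e a w 1 ψ := by
  refine integral_pos_of_ae_pos (hw.integrable_integrand he he0 hψ) ?_
  filter_upwards [hpos] with x hx
  have h0 := sigmoid_pos (a - ψ * e x)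
  simpa using mul_pos hx h0

theorem DampedIntegrable.tendsto_logisticMoment_atTop (he : Measurable e)
    (he0 : ∀ x, 0 < e x) (hw : DampedIntegrable μ e w) :
    Tendsto (logisticMoment μ e a w Q) atTop (𝓝 0) := by
  obtain ⟨C, hC⟩ := exists_abs_eval_sigmoid_le Q
  rw [← integral_zero Ω ℝ (μ := μ)]
  refine tendsto_integral_filter_of_dominated_convergence
    (fun x => C * exp a * ‖w x * exp (-(1 * e x))‖)
    (Eventually.of_forall (hw.aestronglyMeasurable_integrand he a Q))
    ((eventually_ge_atTop 1).mono fun ψ hψ =>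
      ae_of_all _ (norm_integrand_le (fun x => (he0 x).le) hC hψ))
    ((hw.2 1 one_pos).norm.const_mul _) (ae_of_all _ fun x => ?_)
  have h1 : Tendsto (fun ψ : ℝ => a - ψ * e x) atTop atBot :=
    tendsto_atBot_add_const_left _ a
      (tendsto_neg_atTop_atBot.comp (tendsto_id.atTop_mul_const (he0 x)))
  have h2 := tendsto_sigmoid_atBot.comp h1
  simpa using (h2.mul ((Q.continuous.tendsto 0).comp h2)).const_mul (w x)

end LogisticMoment

section InverseFunction

variable {p r q : ℝ → ℝ} {s : Set ℝ}

theorem contDiffAt_of_leftInvOn {n : WithTop ℕ∞} (hn : n ≠ 0) {x : ℝ} (hs : s ∈ 𝓝 x)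
    (hp : ContDiffAt ℝ n p x) (hp' : deriv p x ≠ 0) (hq : LeftInvOn q p s) :
    ContDiffAt ℝ n q (p x) := by
  have hd := (hp.differentiableAt hn).hasDerivAt.hasFDerivAt_equiv hp'
  have hsd := hp.hasStrictFDerivAt' hd hn
  refine (hp.to_localInverse hd hn).congr_of_eventuallyEq ?_
  have hc : Tendsto (hp.localInverse hd hn) (𝓝 (p x)) (𝓝 x) := by
    have := (hp.to_localInverse hd hn).continuousAt.tendsto
    rwa [hp.localInverse_apply_image hd hn] at this
  filter_upwards [hc hs, hsd.eventually_right_inverse] with y hy hy'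
  calc q y = q (p (hp.localInverse hd hn y)) := by rw [ContDiffAt.localInverse, hy']
    _ = _ := hq hy

theorem deriv_comp_inverse_pos {x : ℝ} (hs : s ∈ 𝓝 x) (hp : ContDiffAt ℝ 1 p x)
    (hp' : deriv p x < 0) (hr : DifferentiableAt ℝ r x) (hr' : deriv r x < 0)
    (hq : LeftInvOn q p s) : 0 < deriv (fun y => r (q y)) (p x) := by
  have hqx : q (p x) = x := hq (mem_of_mem_nhds hs)
  have hqd : DifferentiableAt ℝ q (p x) :=
    (contDiffAt_of_leftInvOn one_ne_zero hs hp hp'.ne hq).differentiableAt one_ne_zero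
  have hmul : deriv q (p x) * deriv p x = 1 := by
    have h1 := hqd.hasDerivAt.comp x (hp.differentiableAt one_ne_zero).hasDerivAt
    have h2 : q ∘ p =ᶠ[𝓝 x] id := by filter_upwards [hs] with y hy using hq hy
    exact h1.unique ((hasDerivAt_id x).congr_of_eventuallyEq h2)
  have hneg : deriv q (p x) < 0 := by
    by_contra! h
    nlinarith [mul_nonpos_of_nonneg_of_nonpos h hp'.le]
  have hcomp : HasDerivAt (fun y => r (q y)) (deriv r x * deriv q (p x)) (p x) := by
    have hr2 : HasDerivAt r (deriv r x) (q (p x)) := by rw [hqx]; exact hr.hasDerivAt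
    exact hr2.comp (p x) hqd.hasDerivAt
  rw [hcomp.deriv]
  exact mul_pos_of_neg_of_neg hr' hneg

end InverseFunction

theorem StrictAntiOn.bijOn_Ioi_zero {p : ℝ → ℝ} (hanti : StrictAntiOn p (Ioi 0))
    (hcont : ContinuousOn p (Ioi 0)) (hpos : MapsTo p (Ioi 0) (Ioi 0))
    (h0 : Tendsto p (𝓝[>] 0) atTop) (htop : Tendsto p atTop (𝓝 0)) :
    BijOn p (Ioi 0) (Ioi 0) := by
  refine ⟨hpos, hanti.injOn, fun y hy => ?_⟩
  obtain ⟨x₁, hx₁, hx₁'⟩ :=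
    ((htop.eventually (gt_mem_nhds hy)).and (eventually_gt_atTop 0)).exists
  obtain ⟨x₂, hx₂, hx₂'⟩ :=
    ((h0.eventually (eventually_gt_atTop y)).and self_mem_nhdsWithin).exists
  exact isPreconnected_Ioi.intermediate_value hx₁' hx₂' hcont ⟨hx₁.le, hx₂.le⟩

section Fermi

variable {m : ℝ}

theorem fermiE_pos (hm : 0 < m) (q : ℝ) : 0 < fermiE m q := sqrt_pos.2 (by positivity)

theorem continuous_fermiE_s19 : Continuous (fermiE m) := by
  unfold fermiE; fun_prop

theorem abs_le_fermiE (q : ℝ) : |q| ≤ fermiE m q :=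
  abs_le_sqrt (by nlinarith [sq_nonneg m])

theorem fermiF_eq_sigmoid (hm : 0 < m) (α ψ q : ℝ) :
    fermiF m α ψ q = sigmoid (α - ψ * (α / m * fermiE m q)) := by
  rw [fermiF, sigmoid_def]
  congr 3
  field_simp
  ring

theorem dampedIntegrable_one {c : ℝ} (hc : 0 < c) :
    DampedIntegrable (volume.restrict (Ioi 0)) (fun q => c * fermiE m q) fun _ => 1 := by
  refine ⟨aestronglyMeasurable_const, fun ε hε => ?_⟩
  refine (exp_neg_integrableOn_Ioi 0 (mul_pos hε hc)).mono'
    (by have := continuous_fermiE_s19 (m := m); fun_prop) (ae_of_all _ fun q => ?_)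
  rw [one_mul, norm_eq_abs, abs_exp, exp_le_exp]
  have := mul_le_mul_of_nonneg_left ((le_abs_self q).trans (abs_le_fermiE (m := m) q))
    (mul_pos hε hc).le
  linarith

theorem dampedIntegrable_of_le_cube {c : ℝ} (hm : 0 < m) (hc : 0 < c) {w : ℝ → ℝ}
    (hw : Continuous w) (hle : ∀ q, |w q| ≤ fermiE m q ^ 3) :
    DampedIntegrable (volume.restrict (Ioi 0)) (fun q => c * fermiE m q) w := by
  have hE := continuous_fermiE_s19 (m := m)
  have he : Measurable fun q => c * fermiE m q := (hE.const_mul c).measurable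
  have he0 : ∀ q, 0 ≤ c * fermiE m q := fun q => (mul_pos hc (fermiE_pos hm q)).le
  have h := (((dampedIntegrable_one (m := m) hc).mul_exponent he he0).mul_exponent he he0).mul_exponent he he0
  have h' : DampedIntegrable (volume.restrict (Ioi 0)) (fun q => c * fermiE m q)
      fun q => fermiE m q ^ 3 := by
    refine ⟨(hE.pow 3).aestronglyMeasurable, fun ε hε => ?_⟩
    refine ((h.2 ε hε).const_mul (c⁻¹ ^ 3)).congr (ae_of_all _ fun q => ?_)
    field_simp
  refine h'.mono he hw.aestronglyMeasurable (ae_of_all _ fun q => (hle q).trans (le_abs_self _))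

theorem dampedIntegrable_pressure_weight {c : ℝ} (hm : 0 < m) (hc : 0 < c) :
    DampedIntegrable (volume.restrict (Ioi 0)) (fun q => c * fermiE m q)
      fun q => q ^ 4 / fermiE m q := by
  refine dampedIntegrable_of_le_cube hm hc
    ((continuous_pow 4).div₀ continuous_fermiE_s19 fun q => (fermiE_pos hm q).ne') fun q => ?_
  have hE := fermiE_pos hm q
  rw [abs_div, abs_of_pos hE, div_le_iff₀ hE, abs_pow, ← pow_succ]
  exact pow_le_pow_left₀ (abs_nonneg q) (abs_le_fermiE q) 4

theorem dampedIntegrable_density_weight {c : ℝ} (hm : 0 < m) (hc : 0 < c) :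
    DampedIntegrable (volume.restrict (Ioi 0)) (fun q => c * fermiE m q)
      fun q => q ^ 2 * fermiE m q := by
  refine dampedIntegrable_of_le_cube hm hc ((continuous_pow 2).mul continuous_fermiE_s19) fun q => ?_
  have hE := fermiE_pos hm q
  rw [abs_mul, abs_of_pos hE, abs_pow, pow_succ _ 2]
  gcongr
  exact abs_le_fermiE q

theorem pF_eq_logisticMoment (hm : 0 < m) (α g : ℝ) :
    pF m α g = fun ψ => g / (6 * π ^ 2) * logisticMoment (volume.restrict (Ioi 0))
      (fun q => α / m * fermiE m q) α (fun q => q ^ 4 / fermiE m q) 1 ψ := by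
  ext ψ
  simp [pF, logisticMoment, fermiF_eq_sigmoid hm]

theorem rhoF_eq_logisticMoment (hm : 0 < m) (α g : ℝ) :
    rhoF m α g = fun ψ => g / (2 * π ^ 2) * logisticMoment (volume.restrict (Ioi 0))
      (fun q => α / m * fermiE m q) α (fun q => q ^ 2 * fermiE m q) 1 ψ := by
  ext ψ
  simp [rhoF, logisticMoment, fermiF_eq_sigmoid hm]

theorem le_logisticMoment_pressure {α R : ℝ} (hm : 0 < m) (hα : 0 < α) (hR1 : 1 ≤ R)
    (hRm : m ≤ R) {ψ : ℝ} (hψ : 0 < ψ) (hψR : ψ * fermiE m (R + 1) ≤ m) :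
    R / 4 ≤ logisticMoment (volume.restrict (Ioi 0)) (fun q => α / m * fermiE m q) α
      (fun q => q ^ 4 / fermiE m q) 1 ψ := by
  have hc : 0 < α / m := div_pos hα hm
  have hint := (dampedIntegrable_pressure_weight hm hc).integrable_integrand (a := α) (Q := 1)
    (continuous_fermiE_s19.const_mul _).measurable
    (fun q => (mul_pos hc (fermiE_pos hm q)).le) hψ
  have hsub : Ioc R (R + 1) ⊆ Ioi 0 := fun q hq => by
    have := hq.1; simp only [mem_Ioi]; linarith
  have hle : ∀ q ∈ Ioc R (R + 1), R / 4 ≤ q ^ 4 / fermiE m q *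
      (sigmoid (α - ψ * (α / m * fermiE m q)) *
        (1 : ℝ[X]).eval (sigmoid (α - ψ * (α / m * fermiE m q)))) := fun q hq => by
    have hRq : R ≤ q := hq.1.le
    have hE := fermiE_pos hm q
    have hE2 : fermiE m q ≤ 2 * q := sqrt_le_iff.2 ⟨by linarith, by nlinarith⟩
    have hEmono : fermiE m q ≤ fermiE m (R + 1) := sqrt_le_sqrt (by nlinarith [hq.2])
    have hs : 1 / 2 ≤ sigmoid (α - ψ * (α / m * fermiE m q)) := by
      rw [one_div, ← sigmoid_zero, sigmoid_le_iff, sub_nonneg]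
      calc ψ * (α / m * fermiE m q) = α / m * (ψ * fermiE m q) := by ring
        _ ≤ α / m * m := by gcongr; exact (by gcongr : _ ≤ _).trans hψR
        _ = α := by field_simp
    have hw : R / 2 ≤ q ^ 4 / fermiE m q := by
      rw [le_div_iff₀ hE]
      calc R / 2 * fermiE m q ≤ q / 2 * (2 * q) :=
          mul_le_mul (by linarith) hE2 hE.le (by linarith)
        _ = q ^ 2 := by ring
        _ ≤ q ^ 4 := pow_le_pow_right₀ (hR1.trans hRq) (by norm_num)
    calc R / 4 = R / 2 * (1 / 2) := by ring
      _ ≤ _ := by rw [eval_one, mul_one]; gcongr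
  calc R / 4 = ∫ _ in Ioc R (R + 1), R / 4 := by simp
    _ ≤ ∫ q in Ioc R (R + 1), q ^ 4 / fermiE m q *
      (sigmoid (α - ψ * (α / m * fermiE m q)) *
        (1 : ℝ[X]).eval (sigmoid (α - ψ * (α / m * fermiE m q)))) :=
      setIntegral_mono_on (by simp) (hint.mono_measure (Measure.restrict_mono hsub le_rfl))
        measurableSet_Ioc hle
    _ ≤ _ := by
      refine setIntegral_mono_set hint ?_ hsub.eventuallyLE
      refine ae_of_all _ fun q => ?_
      have := fermiE_pos hm q
      have := sigmoid_pos (α - ψ * (α / m * fermiE m q))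
      simp only [eval_one, Pi.zero_apply]
      positivity

theorem tendsto_logisticMoment_pressure_zero {α : ℝ} (hm : 0 < m) (hα : 0 < α) :
    Tendsto (logisticMoment (volume.restrict (Ioi 0)) (fun q => α / m * fermiE m q) α
      (fun q => q ^ 4 / fermiE m q) 1) (𝓝[>] 0) atTop := by
  refine tendsto_atTop.2 fun b => ?_
  set R := max (max 1 m) (4 * b)
  have hE := fermiE_pos hm (R + 1)
  filter_upwards [Ioc_mem_nhdsGT (div_pos hm hE)] with ψ hψ
  have hR : 4 * b ≤ R := le_max_right _ _
  have := le_logisticMoment_pressure hm hα ((le_max_left 1 m).trans (le_max_left _ _))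
    ((le_max_right 1 m).trans (le_max_left _ _)) hψ.1 ((le_div_iff₀ hE).1 hψ.2)
  linarith

end Fermi

/-- The pressure `p_F` is a strictly decreasing `C^∞` bijection of `(0,∞)` onto
`(0,∞)` (with `p_F(ψ) → ∞` as `ψ → 0⁺` and `p_F(ψ) → 0` as `ψ → ∞`), and the
energy density expressed as a function of the pressure, `ρ = ρ_F ∘ p_F⁻¹`, is an
infinitely smooth function `(0,∞) → (0,∞)` with `dρ/dp > 0` for all `p > 0`. -/
theorem thomas_fermi_equation_of_state_smooth_increasing
    (m α g : ℝ) (hm : 0 < m) (hα : 0 < α) (hg : 0 < g) :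
    StrictAntiOn (pF m α g) (Ioi 0) ∧
    ContDiffOn ℝ (⊤ : ℕ∞) (pF m α g) (Ioi 0) ∧
    BijOn (pF m α g) (Ioi 0) (Ioi 0) ∧
    Filter.Tendsto (pF m α g) (nhdsWithin 0 (Ioi 0)) Filter.atTop ∧
    Filter.Tendsto (pF m α g) Filter.atTop (nhds 0) ∧
    ∃ pinv : ℝ → ℝ,
      (∀ ψ ∈ Ioi (0:ℝ), pinv (pF m α g ψ) = ψ) ∧
      (∀ pr ∈ Ioi (0:ℝ), pF m α g (pinv pr) = pr) ∧
      (∀ pr ∈ Ioi (0:ℝ), 0 < rhoF m α g (pinv pr)) ∧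
      ContDiffOn ℝ (⊤ : ℕ∞) (fun pr => rhoF m α g (pinv pr)) (Ioi 0) ∧
      (∀ pr ∈ Ioi (0:ℝ), 0 < deriv (fun pr' => rhoF m α g (pinv pr')) pr) := by
  have hc : 0 < α / m := div_pos hα hm
  have hkp : 0 < g / (6 * π ^ 2) := by positivity
  have hkr : 0 < g / (2 * π ^ 2) := by positivity
  have he : Measurable fun q => α / m * fermiE m q := (continuous_fermiE_s19.const_mul _).measurable
  have he0 : ∀ q, 0 < α / m * fermiE m q := fun q => mul_pos hc (fermiE_pos hm q)
  have he0' : ∀ q, 0 ≤ α / m * fermiE m q := fun q => (he0 q).le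
  have hwp := dampedIntegrable_pressure_weight hm hc
  have hwr := dampedIntegrable_density_weight hm hc
  have hwp0 : ∀ᵐ q ∂volume.restrict (Ioi (0 : ℝ)), 0 < q ^ 4 / fermiE m q :=
    (ae_restrict_mem measurableSet_Ioi).mono fun q hq =>
      div_pos (pow_pos hq 4) (fermiE_pos hm q)
  have hwr0 : ∀ᵐ q ∂volume.restrict (Ioi (0 : ℝ)), 0 < q ^ 2 * fermiE m q :=
    (ae_restrict_mem measurableSet_Ioi).mono fun q hq =>
      mul_pos (pow_pos hq 2) (fermiE_pos hm q)
  have hμ : NeZero (volume.restrict (Ioi (0 : ℝ))) := ⟨by simp⟩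
  have hpsmooth : ContDiffOn ℝ (⊤ : ℕ∞) (pF m α g) (Ioi 0) := by
    rw [pF_eq_logisticMoment hm]
    exact contDiffOn_const.mul (hwp.contDiffOn_logisticMoment he he0')
  have hrsmooth : ContDiffOn ℝ (⊤ : ℕ∞) (rhoF m α g) (Ioi 0) := by
    rw [rhoF_eq_logisticMoment hm]
    exact contDiffOn_const.mul (hwr.contDiffOn_logisticMoment he he0')
  have hp' : ∀ ψ ∈ Ioi (0 : ℝ), deriv (pF m α g) ψ < 0 := fun ψ hψ => by
    rw [pF_eq_logisticMoment hm, deriv_const_mul_field']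
    exact mul_neg_of_pos_of_neg hkp (hwp.deriv_logisticMoment_one_neg he he0 hwp0 hψ)
  have hr' : ∀ ψ ∈ Ioi (0 : ℝ), deriv (rhoF m α g) ψ < 0 := fun ψ hψ => by
    rw [rhoF_eq_logisticMoment hm, deriv_const_mul_field']
    exact mul_neg_of_pos_of_neg hkr (hwr.deriv_logisticMoment_one_neg he he0 hwr0 hψ)
  have hp0 : MapsTo (pF m α g) (Ioi 0) (Ioi 0) := fun ψ hψ => by
    rw [pF_eq_logisticMoment hm]
    exact mul_pos hkp (hwp.logisticMoment_one_pos he he0' hwp0 hψ)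
  have hr0 : ∀ ψ ∈ Ioi (0 : ℝ), 0 < rhoF m α g ψ := fun ψ hψ => by
    rw [rhoF_eq_logisticMoment hm]
    exact mul_pos hkr (hwr.logisticMoment_one_pos he he0' hwr0 hψ)
  have hanti : StrictAntiOn (pF m α g) (Ioi 0) :=
    strictAntiOn_of_deriv_neg (convex_Ioi 0) hpsmooth.continuousOn (by simpa using hp')
  have hzero : Tendsto (pF m α g) (𝓝[>] 0) atTop := by
    rw [pF_eq_logisticMoment hm]
    exact (tendsto_logisticMoment_pressure_zero hm hα).const_mul_atTop hkp
  have htop : Tendsto (pF m α g) atTop (𝓝 0) := by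
    rw [pF_eq_logisticMoment hm]
    simpa using (hwp.tendsto_logisticMoment_atTop he he0).const_mul (g / (6 * π ^ 2))
  have hbij := hanti.bijOn_Ioi_zero hpsmooth.continuousOn hp0 hzero htop
  have hinv := hbij.invOn_invFunOn
  have hmem : MapsTo (Function.invFunOn (pF m α g) (Ioi 0)) (Ioi 0) (Ioi 0) :=
    hbij.surjOn.mapsTo_invFunOn
  refine ⟨hanti, hpsmooth, hbij, hzero, htop, Function.invFunOn (pF m α g) (Ioi 0),
    hinv.1, hinv.2, fun y hy => hr0 _ (hmem hy), ?_, ?_⟩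
  · refine hrsmooth.comp (fun y hy => ?_) hmem
    obtain ⟨x, hx, rfl⟩ := hbij.surjOn hy
    have hnhds := Ioi_mem_nhds (mem_Ioi.1 hx)
    exact (contDiffAt_of_leftInvOn (by simp) hnhds (hpsmooth.contDiffAt hnhds)
      (hp' x hx).ne hinv.1).contDiffWithinAt
  · intro y hy
    obtain ⟨x, hx, rfl⟩ := hbij.surjOn hy
    have hnhds := Ioi_mem_nhds (mem_Ioi.1 hx)
    exact deriv_comp_inverse_pos hnhds ((hpsmooth.contDiffAt hnhds).of_le (by simp)) (hp' x hx)
      ((hrsmooth.contDiffAt hnhds).differentiableAt (by simp)) (hr' x hx) hinv.1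
end
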